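/- The staggered double ring with two polar vortices D_{Nd}(R,R′,2p) is a relative equilibrium with explicit angular velocity (Theorem 3.7 and Proposition 3.8, case with poles): Let N ≥ 2, θ ∈ (0, π/2] and λ_n ∈ ℝ. Consider the configuration of n = 2N + 2 vortices with positions p j = (sin θ · cos (2πj/N), sin θ · sin (2πj/N), cos θ) of vorticity +1 and q j = (sin θ · cos ((2j+1)π/N), sin θ · sin ((2j+1)π/N), −cos θ) of vorticity −1 for j = 0, …, N−1, together with the North pole (0,0,1) of vorticity λ_n and the South pole (0,0,−1) of vorticity −λ_n. Set ξ = cos θ · [ (N−1)/sin²θ + Σ_{j=0}^{N−1} (1 + cos ((2j+1)π/N)) / (2 − sin²θ · (1 + cos ((2j+1)π/N))) ] + 2·λ_n/sin²θ. Then F(x) i = ξ • ((0,0,1) × x i) for every vortex x i of the configuration (in particular F vanishes at both poles), so the configuration is a relative equilibrium rotating about the z-axis with angular velocity ξ. -/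

import Mathlib

open scoped RealInnerProductSpace BigOperators

noncomputable section

/-- Euclidean 3-space. -/
abbrev R3 : Type := EuclideanSpace ℝ (Fin 3)

/-- The vector of `R3` with the given coordinates. -/
def v3 (a b c : ℝ) : R3 := (WithLp.equiv 2 (Fin 3 → ℝ)).symm ![a, b, c]

/-- Cross product on `R3`. -/
def cross (u v : R3) : R3 :=
  v3 (u 1 * v 2 - u 2 * v 1) (u 2 * v 0 - u 0 * v 2) (u 0 * v 1 - u 1 * v 0)

/-- The point-vortex vector field on the sphere:
`F(x) i = Σ_{j ≠ i} (λ j / (1 − ⟪x i, x j⟫)) • (x j × x i)`. -/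
def vortexF {ι : Type} [Fintype ι] [DecidableEq ι] (lam : ι → ℝ) (x : ι → R3) (i : ι) : R3 :=
  ∑ j ∈ Finset.univ.filter (fun j => j ≠ i), (lam j / (1 - ⟪x i, x j⟫)) • cross (x j) (x i)

/-- The point-vortex Hamiltonian `H(y) = Σ_{i<j} λ i λ j log ‖y i − y j‖²`. -/
def vortexH (n : ℕ) (lam : Fin n → ℝ) (y : Fin n → R3) : ℝ :=
  ∑ p ∈ Finset.univ.filter (fun p : Fin n × Fin n => p.1 < p.2),
    lam p.1 * lam p.2 * Real.log (‖y p.1 - y p.2‖ ^ 2)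

/-- The centre of vorticity `Φ(y) = Σ_i λ i • y i`. -/
def vorticityCentre (n : ℕ) (lam : Fin n → ℝ) (y : Fin n → R3) : R3 := ∑ i, lam i • y i

lemma sum_ring_shift (N : ℕ) (hN : N ≠ 0) (f : ℝ → ℝ) (hf : Function.Periodic f (2 * Real.pi))
    (m k : ℤ) :
    ∑ j : Fin N, f ((2 * ((j : ℕ) : ℝ) + 2 * k + m) * Real.pi / N) =
      ∑ j : Fin N, f ((2 * ((j : ℕ) : ℝ) + m) * Real.pi / N) := by
  have hN' : (N : ℝ) ≠ 0 := by exact_mod_cast hN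
  have step : ∀ k : ℤ, ∑ j ∈ Finset.range N, f ((2 * (j : ℝ) + 2 * (k + 1 : ℤ) + m) * Real.pi / N) =
      ∑ j ∈ Finset.range N, f ((2 * (j : ℝ) + 2 * k + m) * Real.pi / N) := by
    intro k
    have h1 := Finset.sum_range_succ
      (fun j : ℕ => f ((2 * (j : ℝ) + 2 * k + m) * Real.pi / N)) N
    have h2 := Finset.sum_range_succ'
      (fun j : ℕ => f ((2 * (j : ℝ) + 2 * k + m) * Real.pi / N)) N
    have h3 : f ((2 * (N : ℝ) + 2 * k + m) * Real.pi / N) =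
        f ((2 * ((0 : ℕ) : ℝ) + 2 * k + m) * Real.pi / N) := by
      rw [← hf ((2 * ((0 : ℕ) : ℝ) + 2 * k + m) * Real.pi / N)]
      congr 1
      push_cast
      field_simp
      ring
    have h4 : ∑ j ∈ Finset.range N, f ((2 * (j : ℝ) + 2 * (k + 1 : ℤ) + m) * Real.pi / N) =
        ∑ j ∈ Finset.range N, f ((2 * ((j + 1 : ℕ) : ℝ) + 2 * k + m) * Real.pi / N) := by
      refine Finset.sum_congr rfl fun j _ => ?_
      congr 1
      push_cast
      ring
    linarith
  rw [Fin.sum_univ_eq_sum_range (fun j : ℕ => f ((2 * (j : ℝ) + 2 * k + m) * Real.pi / N)),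
    Fin.sum_univ_eq_sum_range (fun j : ℕ => f ((2 * (j : ℝ) + m) * Real.pi / N))]
  induction k using Int.induction_on with
  | zero => simp
  | succ i ih => rw [step, ih]
  | pred i ih =>
    rw [← ih, ← step]
    simp

lemma sum_ring_eq_zero_of_odd (N : ℕ) (hN : N ≠ 0) (f : ℝ → ℝ)
    (hf : Function.Periodic f (2 * Real.pi)) (hodd : Function.Odd f) (m : ℤ) :
    ∑ j : Fin N, f ((2 * ((j : ℕ) : ℝ) + m) * Real.pi / N) = 0 := by
  have hN' : (N : ℝ) ≠ 0 := by exact_mod_cast hN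
  have h := sum_ring_shift N hN f hf m (1 - m)
  have hrefl : ∑ j : Fin N, f ((2 * ((j : ℕ) : ℝ) + m) * Real.pi / N) =
      -∑ j : Fin N, f ((2 * ((j : ℕ) : ℝ) + 2 * (1 - m : ℤ) + m) * Real.pi / N) := by
    rw [← Equiv.sum_comp Fin.revPerm, ← Finset.sum_neg_distrib]
    refine Finset.sum_congr rfl fun j _ => ?_
    rw [← hodd, ← hf (-_)]
    congr 1
    have hj : ((Fin.revPerm j : Fin N) : ℕ) = N - (j + 1) := by simp [Fin.val_rev]
    rw [hj, Nat.cast_sub (by omega)]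
    push_cast
    field_simp
    ring
  linarith

lemma sum_ring_sin (N : ℕ) (hN : N ≠ 0) (m : ℤ) :
    ∑ j : Fin N, Real.sin ((2 * ((j : ℕ) : ℝ) + m) * Real.pi / N) = 0 :=
  sum_ring_eq_zero_of_odd N hN _ Real.sin_periodic Real.sin_neg m

lemma sum_ring_cos (N : ℕ) (hN : 2 ≤ N) (m : ℤ) :
    ∑ j : Fin N, Real.cos ((2 * ((j : ℕ) : ℝ) + m) * Real.pi / N) = 0 := by
  have hN0 : N ≠ 0 := by omega
  have hN' : (2 : ℝ) ≤ N := by exact_mod_cast hN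
  have hs : 0 < Real.sin (Real.pi / N) := by
    apply Real.sin_pos_of_pos_of_lt_pi
    · have := Real.pi_pos
      positivity
    · exact div_lt_self Real.pi_pos (by linarith)
  have h : 2 * Real.sin (Real.pi / N) *
      ∑ j : Fin N, Real.cos ((2 * ((j : ℕ) : ℝ) + m) * Real.pi / N) = 0 := by
    have e : ∀ j : Fin N, 2 * Real.sin (Real.pi / N) *
        Real.cos ((2 * ((j : ℕ) : ℝ) + m) * Real.pi / N) =
        Real.sin ((2 * ((j : ℕ) : ℝ) + (m + 1 : ℤ)) * Real.pi / N) -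
        Real.sin ((2 * ((j : ℕ) : ℝ) + (m - 1 : ℤ)) * Real.pi / N) := by
      intro j
      have e1 : (2 * ((j : ℕ) : ℝ) + (m + 1 : ℤ)) * Real.pi / N =
        (2 * ((j : ℕ) : ℝ) + m) * Real.pi / N + Real.pi / N := by push_cast; ring
      have e2 : (2 * ((j : ℕ) : ℝ) + (m - 1 : ℤ)) * Real.pi / N =
        (2 * ((j : ℕ) : ℝ) + m) * Real.pi / N - Real.pi / N := by push_cast; ring
      rw [e1, e2, Real.sin_add, Real.sin_sub]
      ring
    rw [Finset.mul_sum, Finset.sum_congr rfl fun j _ => e j, Finset.sum_sub_distrib,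
      sum_ring_sin N hN0, sum_ring_sin N hN0, sub_zero]
  exact (mul_eq_zero.mp h).resolve_left (by positivity)

lemma sum_ring_one_sub_cos_div_self (N : ℕ) (hN : N ≠ 0) :
    ∑ j : Fin N, (1 - Real.cos (2 * ((j : ℕ) : ℝ) * Real.pi / N)) /
      (1 - Real.cos (2 * ((j : ℕ) : ℝ) * Real.pi / N)) = (N : ℝ) - 1 := by
  obtain ⟨M, rfl⟩ := Nat.exists_eq_succ_of_ne_zero hN
  rw [Fin.sum_univ_succ]
  have h : ∀ j : Fin M,
      (1 - Real.cos (2 * ((j.succ : ℕ) : ℝ) * Real.pi / (M.succ : ℕ))) /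
      (1 - Real.cos (2 * ((j.succ : ℕ) : ℝ) * Real.pi / (M.succ : ℕ))) = 1 := by
    intro j
    apply div_self
    have hpi := Real.pi_pos
    have hj : (((j.succ : Fin (M + 1)) : ℕ) : ℝ) < (M.succ : ℕ) := by
      exact_mod_cast j.succ.isLt
    have hj0 : (0 : ℝ) < ((j.succ : Fin (M + 1)) : ℕ) := by
      exact_mod_cast Nat.succ_pos _
    have hM : (0 : ℝ) < (M.succ : ℕ) := by linarith
    intro h0
    have h1 := (Real.cos_eq_one_iff_of_lt_of_lt
      (by
        have : 0 < 2 * ((j.succ : ℕ) : ℝ) * Real.pi / (M.succ : ℕ) := by positivity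
        linarith)
      (by
        rw [div_lt_iff₀ hM]
        nlinarith)).mp (sub_eq_zero.mp h0).symm
    have : 0 < 2 * ((j.succ : ℕ) : ℝ) * Real.pi / (M.succ : ℕ) := by positivity
    exact this.ne' h1
  rw [Finset.sum_congr rfl fun j _ => h j]
  simp

@[simp] lemma v3_zero_apply (a b c : ℝ) : v3 a b c 0 = a := rfl

@[simp] lemma v3_one_apply (a b c : ℝ) : v3 a b c 1 = b := rfl

@[simp] lemma v3_two_apply (a b c : ℝ) : v3 a b c 2 = c := rfl

lemma R3.ext {u v : R3} (h0 : u 0 = v 0) (h1 : u 1 = v 1) (h2 : u 2 = v 2) : u = v := by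
  ext i
  fin_cases i <;> assumption

lemma inner_v3 (a b c a' b' c' : ℝ) :
    ⟪v3 a b c, v3 a' b' c'⟫ = a * a' + b * b' + c * c' := by
  simp [PiLp.inner_apply, Fin.sum_univ_three, mul_comm]

lemma R3.cross_self (u : R3) : cross u u = 0 := by
  apply R3.ext <;> simp [cross] <;> ring

lemma vortexF_eq_sum {ι : Type} [Fintype ι] [DecidableEq ι] (lam : ι → ℝ) (x : ι → R3) (i : ι) :
    vortexF lam x i = ∑ j, (lam j / (1 - ⟪x i, x j⟫)) • cross (x j) (x i) := by
  unfold vortexF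
  apply Finset.sum_subset (Finset.subset_univ _)
  intro j _ hj
  have : j = i := by simpa using hj
  rw [this, R3.cross_self, smul_zero]

/-- The velocity induced by a single vortex, in the frame adapted to the point it acts on. -/
lemma vortex_velocity (κ s z z' α δ : ℝ) :
    (κ / (1 - ⟪v3 (s * Real.cos α) (s * Real.sin α) z,
        v3 (s * Real.cos (α + δ)) (s * Real.sin (α + δ)) z'⟫)) •
      cross (v3 (s * Real.cos (α + δ)) (s * Real.sin (α + δ)) z')
        (v3 (s * Real.cos α) (s * Real.sin α) z) =
    (κ * (z' - z * Real.cos δ) / (1 - (s ^ 2 * Real.cos δ + z * z'))) •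
        cross (v3 0 0 1) (v3 (s * Real.cos α) (s * Real.sin α) z) +
      (Real.sin δ / (1 - (s ^ 2 * Real.cos δ + z * z'))) •
        v3 (κ * s * z * Real.cos α) (κ * s * z * Real.sin α) (-(κ * s ^ 2)) := by
  have hα := Real.sin_sq_add_cos_sq α
  have hin : ⟪v3 (s * Real.cos α) (s * Real.sin α) z,
      v3 (s * Real.cos (α + δ)) (s * Real.sin (α + δ)) z'⟫ = s ^ 2 * Real.cos δ + z * z' := by
    rw [inner_v3, Real.cos_add, Real.sin_add]
    linear_combination s ^ 2 * Real.cos δ * hα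
  rw [hin]
  apply R3.ext <;> simp [cross, Real.cos_add, Real.sin_add, div_eq_mul_inv]
  · ring
  · ring
  · linear_combination (-(κ * (1 - (s ^ 2 * Real.cos δ + z * z'))⁻¹ * s ^ 2 * Real.sin δ)) * hα

lemma ring_velocity (N : ℕ) (hN : N ≠ 0) (κ s z z' α : ℝ) (m k : ℤ) (β : Fin N → ℝ)
    (hβ : ∀ j : Fin N, β j = α + (2 * ((j : ℕ) : ℝ) + 2 * k + m) * Real.pi / N) :
    ∑ j : Fin N, (κ / (1 - ⟪v3 (s * Real.cos α) (s * Real.sin α) z,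
        v3 (s * Real.cos (β j)) (s * Real.sin (β j)) z'⟫)) •
      cross (v3 (s * Real.cos (β j)) (s * Real.sin (β j)) z')
        (v3 (s * Real.cos α) (s * Real.sin α) z) =
    (∑ j : Fin N, κ * (z' - z * Real.cos ((2 * ((j : ℕ) : ℝ) + m) * Real.pi / N)) /
        (1 - (s ^ 2 * Real.cos ((2 * ((j : ℕ) : ℝ) + m) * Real.pi / N) + z * z'))) •
      cross (v3 0 0 1) (v3 (s * Real.cos α) (s * Real.sin α) z) := by
  simp only [hβ, vortex_velocity]
  rw [Finset.sum_add_distrib, ← Finset.sum_smul, ← Finset.sum_smul,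
    sum_ring_shift N hN
      (fun δ => κ * (z' - z * Real.cos δ) / (1 - (s ^ 2 * Real.cos δ + z * z')))
      (fun δ => by simp only [Real.cos_add_two_pi]),
    sum_ring_shift N hN (fun δ => Real.sin δ / (1 - (s ^ 2 * Real.cos δ + z * z')))
      (fun δ => by simp only [Real.cos_add_two_pi, Real.sin_add_two_pi]),
    sum_ring_eq_zero_of_odd N hN (fun δ => Real.sin δ / (1 - (s ^ 2 * Real.cos δ + z * z')))
      (fun δ => by simp only [Real.cos_add_two_pi, Real.sin_add_two_pi])
      (fun δ => by simp only [Real.cos_neg, Real.sin_neg, neg_div]),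
    zero_smul, add_zero]

lemma ring_velocity_at_pole (N : ℕ) (hN : 2 ≤ N) (κ s z z' : ℝ) (m : ℤ) (β : Fin N → ℝ)
    (hβ : ∀ j : Fin N, β j = (2 * ((j : ℕ) : ℝ) + m) * Real.pi / N) :
    ∑ j : Fin N, (κ / (1 - ⟪v3 0 0 z, v3 (s * Real.cos (β j)) (s * Real.sin (β j)) z'⟫)) •
      cross (v3 (s * Real.cos (β j)) (s * Real.sin (β j)) z') (v3 0 0 z) = 0 := by
  have h : ∀ j : Fin N,
      (κ / (1 - ⟪v3 0 0 z, v3 (s * Real.cos (β j)) (s * Real.sin (β j)) z'⟫)) •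
      cross (v3 (s * Real.cos (β j)) (s * Real.sin (β j)) z') (v3 0 0 z) =
      Real.sin ((2 * ((j : ℕ) : ℝ) + m) * Real.pi / N) • v3 (κ / (1 - z * z') * s * z) 0 0 +
      Real.cos ((2 * ((j : ℕ) : ℝ) + m) * Real.pi / N) •
        v3 0 (-(κ / (1 - z * z') * s * z)) 0 := by
    intro j
    rw [inner_v3, hβ]
    apply R3.ext <;> simp [cross] <;> ring
  rw [Finset.sum_congr rfl fun j _ => h j, Finset.sum_add_distrib, ← Finset.sum_smul,
    ← Finset.sum_smul, sum_ring_sin N (by omega), sum_ring_cos N hN, zero_smul, zero_smul, add_zero]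

lemma same_ring_rate (N : ℕ) (hN : N ≠ 0) (κ s z : ℝ) (hsz : s ^ 2 + z ^ 2 = 1) :
    ∑ j : Fin N, κ * (z - z * Real.cos ((2 * ((j : ℕ) : ℝ) + (0 : ℤ)) * Real.pi / N)) /
        (1 - (s ^ 2 * Real.cos ((2 * ((j : ℕ) : ℝ) + (0 : ℤ)) * Real.pi / N) + z * z)) =
      κ * z * (((N : ℝ) - 1) / s ^ 2) := by
  rw [← sum_ring_one_sub_cos_div_self N hN, Finset.sum_div, Finset.mul_sum]
  refine Finset.sum_congr rfl fun j _ => ?_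
  simp only [Int.cast_zero, add_zero]
  generalize Real.cos (2 * ((j : ℕ) : ℝ) * Real.pi / N) = a
  rw [show 1 - (s ^ 2 * a + z * z) = (1 - a) * s ^ 2 by linear_combination -hsz,
    div_div, ← mul_div_assoc]
  ring

lemma opposite_ring_rate (N : ℕ) (κ s z : ℝ) (hsz : s ^ 2 + z ^ 2 = 1) :
    ∑ j : Fin N, κ * (-z - z * Real.cos ((2 * ((j : ℕ) : ℝ) + (1 : ℤ)) * Real.pi / N)) /
        (1 - (s ^ 2 * Real.cos ((2 * ((j : ℕ) : ℝ) + (1 : ℤ)) * Real.pi / N) + z * -z)) =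
      -(κ * z) * ∑ j : Fin N, (1 + Real.cos ((2 * ((j : ℕ) : ℝ) + 1) * Real.pi / (N : ℝ))) /
        (2 - s ^ 2 * (1 + Real.cos ((2 * ((j : ℕ) : ℝ) + 1) * Real.pi / (N : ℝ)))) := by
  rw [Finset.mul_sum]
  refine Finset.sum_congr rfl fun j _ => ?_
  simp only [Int.cast_one]
  generalize Real.cos ((2 * ((j : ℕ) : ℝ) + 1) * Real.pi / N) = a
  rw [show 1 - (s ^ 2 * a + z * -z) = 2 - s ^ 2 * (1 + a) by linear_combination hsz]
  ring

/-- The velocity induced by the two polar vortices away from the poles. -/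
lemma poles_velocity (κ s z a b : ℝ) (hsz : s ^ 2 + z ^ 2 = 1) (hs : s ≠ 0) :
    (κ / (1 - ⟪v3 a b z, v3 0 0 1⟫)) • cross (v3 0 0 1) (v3 a b z) +
      (-κ / (1 - ⟪v3 a b z, v3 0 0 (-1)⟫)) • cross (v3 0 0 (-1)) (v3 a b z) =
    (2 * κ / s ^ 2) • cross (v3 0 0 1) (v3 a b z) := by
  have hprod : (1 - z) * (1 + z) = s ^ 2 := by linear_combination -hsz
  have hne : (1 - z) * (1 + z) ≠ 0 := by rw [hprod]; positivity
  have h1 : 1 - z ≠ 0 := left_ne_zero_of_mul hne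
  have h2 : 1 + z ≠ 0 := right_ne_zero_of_mul hne
  have hk : κ / (1 - z) + κ / (1 + z) = 2 * κ / s ^ 2 := by
    rw [← hprod]
    field_simp
    ring
  have hc : cross (v3 0 0 (-1)) (v3 a b z) = -cross (v3 0 0 1) (v3 a b z) := by
    apply R3.ext <;> simp [cross]
  rw [← hk, hc, inner_v3, inner_v3, add_smul]
  simp [neg_div]

/-- the staggered double ring with two polar vortices `D_{Nd}(R,R′,2p)` is a
relative equilibrium rotating about the `z`-axis with the explicit angular velocity of
Proposition 3.8 (`k_p = 2`); the pole indices are `Sum.inr true` (North, strength `λ_n`)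
and `Sum.inr false` (South, strength `−λ_n`). -/
theorem DNd_double_ring_poles_relative_equilibrium (N : ℕ) (hN : 2 ≤ N)
    (θ : ℝ) (hθ : θ ∈ Set.Ioc 0 (Real.pi / 2)) (lamn : ℝ)
    (lam : (Fin N ⊕ Fin N) ⊕ Bool → ℝ) (x : (Fin N ⊕ Fin N) ⊕ Bool → R3) (ξ : ℝ)
    (hlamp : ∀ j : Fin N, lam (Sum.inl (Sum.inl j)) = 1)
    (hlamm : ∀ j : Fin N, lam (Sum.inl (Sum.inr j)) = -1)
    (hlamn : lam (Sum.inr true) = lamn) (hlams : lam (Sum.inr false) = -lamn)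
    (hxp : ∀ j : Fin N, x (Sum.inl (Sum.inl j)) =
      v3 (Real.sin θ * Real.cos (2 * Real.pi * ((j : ℕ) : ℝ) / (N : ℝ)))
         (Real.sin θ * Real.sin (2 * Real.pi * ((j : ℕ) : ℝ) / (N : ℝ)))
         (Real.cos θ))
    (hxm : ∀ j : Fin N, x (Sum.inl (Sum.inr j)) =
      v3 (Real.sin θ * Real.cos ((2 * ((j : ℕ) : ℝ) + 1) * Real.pi / (N : ℝ)))
         (Real.sin θ * Real.sin ((2 * ((j : ℕ) : ℝ) + 1) * Real.pi / (N : ℝ)))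
         (-Real.cos θ))
    (hxn : x (Sum.inr true) = v3 0 0 1) (hxs : x (Sum.inr false) = v3 0 0 (-1))
    (hξ : ξ = Real.cos θ * (((N : ℝ) - 1) / Real.sin θ ^ 2 +
      ∑ j : Fin N, (1 + Real.cos ((2 * ((j : ℕ) : ℝ) + 1) * Real.pi / (N : ℝ))) /
        (2 - Real.sin θ ^ 2 *
          (1 + Real.cos ((2 * ((j : ℕ) : ℝ) + 1) * Real.pi / (N : ℝ)))))
      + 2 * lamn / Real.sin θ ^ 2) :
    ∀ i, vortexF lam x i = ξ • cross (v3 0 0 1) (x i) := by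
  have hN0 : N ≠ 0 := by omega
  have hs : Real.sin θ ≠ 0 :=
    (Real.sin_pos_of_pos_of_lt_pi hθ.1 (by linarith [hθ.2, Real.pi_pos])).ne'
  have hsz := Real.sin_sq_add_cos_sq θ
  have hsz' : Real.sin θ ^ 2 + (-Real.cos θ) ^ 2 = 1 := by rw [neg_sq]; exact hsz
  intro i
  rw [vortexF_eq_sum, Fintype.sum_sum_type, Fintype.sum_sum_type, Fintype.sum_bool]
  rcases i with (i | i) | (_ | _)
  · simp only [hlamp, hlamm, hlamn, hlams, hxp, hxm, hxn, hxs]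
    rw [poles_velocity _ _ _ _ _ hsz hs,
      ring_velocity N hN0 1 _ _ _ _ 0 (-(i : ℕ))
        (fun j : Fin N => 2 * Real.pi * ((j : ℕ) : ℝ) / (N : ℝ))
        (fun j => by push_cast; ring),
      ring_velocity N hN0 (-1) _ _ _ _ 1 (-(i : ℕ))
        (fun j : Fin N => (2 * ((j : ℕ) : ℝ) + 1) * Real.pi / (N : ℝ))
        (fun j => by push_cast; ring),
      same_ring_rate N hN0 _ _ _ hsz, opposite_ring_rate N _ _ _ hsz,
      ← add_smul, ← add_smul, hξ]
    congr 1
    ring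
  · have hopp := opposite_ring_rate N 1 _ _ hsz'
    rw [neg_neg] at hopp
    simp only [hlamp, hlamm, hlamn, hlams, hxp, hxm, hxn, hxs]
    rw [poles_velocity _ _ _ _ _ hsz' hs,
      ring_velocity N hN0 1 _ _ _ _ 1 (-(i : ℕ) - 1)
        (fun j : Fin N => 2 * Real.pi * ((j : ℕ) : ℝ) / (N : ℝ))
        (fun j => by push_cast; ring),
      ring_velocity N hN0 (-1) _ _ _ _ 0 (-(i : ℕ))
        (fun j : Fin N => (2 * ((j : ℕ) : ℝ) + 1) * Real.pi / (N : ℝ))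
        (fun j => by push_cast; ring),
      same_ring_rate N hN0 _ _ _ hsz', hopp,
      ← add_smul, ← add_smul, hξ]
    congr 1
    ring
  all_goals
    simp only [hlamp, hlamm, hlamn, hlams, hxp, hxm, hxn, hxs]
    rw [ring_velocity_at_pole N hN 1 _ _ _ 0
        (fun j : Fin N => 2 * Real.pi * ((j : ℕ) : ℝ) / (N : ℝ))
        (fun j => by push_cast; ring),
      ring_velocity_at_pole N hN (-1) _ _ _ 1
        (fun j : Fin N => (2 * ((j : ℕ) : ℝ) + 1) * Real.pi / (N : ℝ))
        (fun j => by push_cast; ring)]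
    apply R3.ext <;> simp [cross]
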